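/- Suppose 3m ≤ n and n ∉ {4m − 1, 4m}. Then every automorphism f of the geometry P_m is induced by a permutation of {1,…,n}: there exists a permutation σ of {1,…,n} such that f(I) = σ(I) (the image of I under σ) for every 2m-element subset I of {1,…,n}. -/

import Mathlib

open scoped symmDiff

/-- A bijection of the set of `2m`-element subsets of `{1,…,n}` preserving collinearity
in both directions and compatible with the line structure: an automorphism of `P_m`. -/
def IsAutPm (n m : ℕ) (f : Finset (Fin n) → Finset (Fin n)) : Prop :=
  Set.BijOn f {I : Finset (Fin n) | I.card = 2 * m}
      {I : Finset (Fin n) | I.card = 2 * m} ∧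
  (∀ I J : Finset (Fin n), I.card = 2 * m → J.card = 2 * m →
    ((I ∩ J).card = m ↔ (f I ∩ f J).card = m)) ∧
  (∀ I J : Finset (Fin n), I.card = 2 * m → J.card = 2 * m → (I ∩ J).card = m →
    f (I ∆ J) = f I ∆ f J)

section Additive

variable {α R : Type*} [DecidableEq α] [CommRing R]

theorem card_symmDiff_add_two_mul_card_inter (A B : Finset α) :
    (A ∆ B).card + 2 * (A ∩ B).card = A.card + B.card := by
  have h1 := Finset.card_sdiff_add_card_inter A B
  have h2 := Finset.card_sdiff_add_card_inter B A
  have h3 : (A ∆ B).card = (A \ B).card + (B \ A).card := by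
    rw [symmDiff_def, Finset.sup_eq_union, Finset.card_union_of_disjoint disjoint_sdiff_sdiff]
  rw [Finset.inter_comm B A] at h2
  omega

theorem sum_symmDiff_of_two_eq_zero (h2 : (2 : R) = 0) (h : α → R) (A B : Finset α) :
    ∑ i ∈ A ∆ B, h i = ∑ i ∈ A, h i + ∑ i ∈ B, h i := by
  have hA := Finset.sum_inter_add_sum_sdiff A B h
  have hB := Finset.sum_inter_add_sum_sdiff B A h
  rw [Finset.inter_comm B A] at hB
  rw [symmDiff_def, Finset.sup_eq_union, Finset.sum_union disjoint_sdiff_sdiff]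
  linear_combination hA + hB - (∑ i ∈ A ∩ B, h i) * h2

/-- A function on the `k`-element subsets of `S` which does not change when one element is
exchanged for another one is constant. -/
theorem eq_of_forall_exchange {β : Type*} (S : Finset α) (k : ℕ) (G : Finset α → β)
    (hG : ∀ Y a b, a ∈ S → b ∈ S → Y ⊆ S → a ∉ Y → b ∉ Y → a ≠ b → Y.card + 1 = k →
      G (insert a Y) = G (insert b Y))
    (X X' : Finset α) (hX : X ⊆ S) (hX' : X' ⊆ S) (hc : X.card = k) (hc' : X'.card = k) :
    G X = G X' := by
  induction hd : (X \ X').card generalizing X with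
  | zero =>
    have hsub : X ⊆ X' := by
      rwa [Finset.card_eq_zero, Finset.sdiff_eq_empty_iff_subset] at hd
    rw [Finset.eq_of_subset_of_card_le hsub (by omega)]
  | succ d ih =>
    have hd' : (X' \ X).card = d + 1 := by
      rw [← hd]; exact (Finset.card_sdiff_comm (by omega)).symm
    obtain ⟨a, ha⟩ := Finset.card_pos.1 (by omega : 0 < (X \ X').card)
    obtain ⟨b, hb⟩ := Finset.card_pos.1 (by omega : 0 < (X' \ X).card)
    rw [Finset.mem_sdiff] at ha hb
    have hce := Finset.card_erase_add_one ha.1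
    have hbe : b ∉ X.erase a := fun h => hb.2 (Finset.mem_of_mem_erase h)
    have hsub : X.erase a ⊆ S := (Finset.erase_subset _ _).trans hX
    have h1 := hG (X.erase a) a b (hX ha.1) (hX' hb.1) hsub (Finset.notMem_erase _ _) hbe
      (fun h => hb.2 (h ▸ ha.1)) (by omega)
    rw [Finset.insert_erase ha.1] at h1
    rw [h1]
    refine ih _ (Finset.insert_subset (hX' hb.1) hsub)
      (by rw [Finset.card_insert_of_notMem hbe]; omega) ?_
    have h2 : insert b (X.erase a) \ X' = (X \ X').erase a := by
      clear hG ih hd hd' hce h1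
      ext x; grind
    rw [h2, Finset.card_erase_of_mem (by simp [ha]), hd]
    rfl

/-- Additivity along the lines `{I, J, I ∆ J}` of the geometry of `2m`-element subsets. -/
def IsLineAdditive (m : ℕ) (F : Finset α → R) : Prop :=
  ∀ I J : Finset α, I.card = 2 * m → J.card = 2 * m → (I ∩ J).card = m →
    F (I ∆ J) = F I + F J

theorem IsLineAdditive.insert_add_insert_of_card_inter {m : ℕ} {F : Finset α → R}
    (hF : IsLineAdditive m F) (h2 : (2 : R) = 0) {i j : α} (hij : i ≠ j) {X X' : Finset α}
    (hi : i ∉ X) (hj : j ∉ X) (hi' : i ∉ X') (hj' : j ∉ X')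
    (hX : X.card + 1 = 2 * m) (hX' : X'.card + 1 = 2 * m)
    (hc : (X ∩ X').card + 1 = m ∨ (X ∩ X').card = m) :
    F (insert i X) + F (insert j X) = F (insert i X') + F (insert j X') := by
  have hs := card_symmDiff_add_two_mul_card_inter X X'
  have hd := Finset.card_sdiff_add_card_inter X X'
  have hci := Finset.card_insert_of_notMem hi
  have hcj := Finset.card_insert_of_notMem hj
  rcases hc with hc | hc
  · have ei : insert i X ∩ (X ∆ X') = X \ X' := by ext x; grind [Finset.mem_symmDiff]
    have ej : insert j X ∩ (X ∆ X') = X \ X' := by ext x; grind [Finset.mem_symmDiff]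
    have ti : insert i X ∆ (X ∆ X') = insert i X' := by ext x; grind [Finset.mem_symmDiff]
    have tj : insert j X ∆ (X ∆ X') = insert j X' := by ext x; grind [Finset.mem_symmDiff]
    have h3 := hF (insert i X) (X ∆ X') (by omega) (by omega) (by rw [ei]; omega)
    have h4 := hF (insert j X) (X ∆ X') (by omega) (by omega) (by rw [ej]; omega)
    rw [ti] at h3
    rw [tj] at h4
    linear_combination -h3 - h4 - F (X ∆ X') * h2
  · have hiK : i ∉ insert j (X ∆ X') := by grind [Finset.mem_symmDiff]
    have hjK : j ∉ X ∆ X' := by grind [Finset.mem_symmDiff]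
    have hK : (insert i (insert j (X ∆ X'))).card = (X ∆ X').card + 2 := by
      rw [Finset.card_insert_of_notMem hiK, Finset.card_insert_of_notMem hjK]
    have ei : insert i X ∩ insert i (insert j (X ∆ X')) = insert i (X \ X') := by
      ext x; grind [Finset.mem_symmDiff]
    have ej : insert j X ∩ insert i (insert j (X ∆ X')) = insert j (X \ X') := by
      ext x; grind [Finset.mem_symmDiff]
    have ti : insert i X ∆ insert i (insert j (X ∆ X')) = insert j X' := by
      ext x; grind [Finset.mem_symmDiff]
    have tj : insert j X ∆ insert i (insert j (X ∆ X')) = insert i X' := by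
      ext x; grind [Finset.mem_symmDiff]
    have h3 := hF (insert i X) _ (by omega) (by omega : (insert i (insert j (X ∆ X'))).card = _)
      (by rw [ei, Finset.card_insert_of_notMem (by simp [hi])]; omega)
    have h4 := hF (insert j X) _ (by omega) (by omega : (insert i (insert j (X ∆ X'))).card = _)
      (by rw [ej, Finset.card_insert_of_notMem (by simp [hj])]; omega)
    rw [ti] at h3
    rw [tj] at h4
    linear_combination -h3 - h4 - F (insert i (insert j (X ∆ X'))) * h2

variable [Fintype α]

theorem exists_subset_compl_card_eq (T : Finset α) (k : ℕ)
    (h : T.card + k ≤ Fintype.card α) : ∃ X : Finset α, Disjoint X T ∧ X.card = k := by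
  obtain ⟨X, hX, hc⟩ := Finset.exists_subset_card_eq (s := Tᶜ) (n := k)
    (by rw [Finset.card_compl]; omega)
  exact ⟨X, Finset.disjoint_left.2 fun x hx => Finset.mem_compl.1 (hX hx), hc⟩

theorem IsLineAdditive.insert_add_insert_exchange {m : ℕ} {F : Finset α → R}
    (hF : IsLineAdditive m F) (h2 : (2 : R) = 0) (hm : 0 < m) (hn : 3 * m ≤ Fintype.card α)
    {i j : α} (hij : i ≠ j) {Y : Finset α} {a b : α} (hab : a ≠ b)
    (hi : i ∉ Y) (hj : j ∉ Y) (ha : a ∉ Y) (hb : b ∉ Y) (hai : a ≠ i) (haj : a ≠ j)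
    (hbi : b ≠ i) (hbj : b ≠ j) (hY : Y.card + 2 = 2 * m) :
    F (insert i (insert a Y)) + F (insert j (insert a Y)) =
      F (insert i (insert b Y)) + F (insert j (insert b Y)) := by
  have hca := Finset.card_insert_of_notMem ha
  have hcb := Finset.card_insert_of_notMem hb
  have hinter : insert a Y ∩ insert b Y = Y := by ext x; grind
  obtain rfl | hm2 : m = 1 ∨ 2 ≤ m := by omega
  · exact hF.insert_add_insert_of_card_inter h2 hij (by grind) (by grind) (by grind) (by grind)
      (by omega) (by omega) (Or.inl (by rw [hinter]; omega))
  · obtain ⟨P, hPY, hP⟩ := Finset.exists_subset_card_eq (s := Y) (n := m - 1) (by omega)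
    have hT : (Y ∪ {a, b, i, j}).card ≤ Y.card + 4 :=
      (Finset.card_union_le _ _).trans (Nat.add_le_add_left Finset.card_le_four _)
    obtain ⟨Q, hQd, hQ⟩ := exists_subset_compl_card_eq (Y ∪ {a, b, i, j}) (m - 2) (by omega)
    have hQn : ∀ x ∈ Q, x ∉ Y ∧ x ≠ a ∧ x ≠ b ∧ x ≠ i ∧ x ≠ j := by
      intro x hx
      have := Finset.disjoint_left.1 hQd hx
      simp only [Finset.mem_union, Finset.mem_insert, Finset.mem_singleton, not_or] at this
      exact this
    have hPQ : Disjoint P Q := Finset.disjoint_left.2 fun x hx hx' => (hQn x hx').1 (hPY hx)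
    have hcPQ := Finset.card_union_of_disjoint hPQ
    have haP : a ∉ P := fun h => ha (hPY h)
    have hbP : b ∉ P := fun h => hb (hPY h)
    have hbPQ : b ∉ P ∪ Q := by grind
    have haPQ : a ∉ insert b (P ∪ Q) := by grind
    have hcZ := Finset.card_insert_of_notMem haPQ
    have hcZ' := Finset.card_insert_of_notMem hbPQ
    have e1 : insert a Y ∩ insert a (insert b (P ∪ Q)) = insert a P := by ext x; grind
    have e2 : insert a (insert b (P ∪ Q)) ∩ insert b Y = insert b P := by ext x; grind
    rw [hF.insert_add_insert_of_card_inter h2 hij (X := insert a Y)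
      (X' := insert a (insert b (P ∪ Q))) (by grind) (by grind) (by grind) (by grind)
      (by omega) (by omega)
      (Or.inr (by rw [e1, Finset.card_insert_of_notMem haP]; omega))]
    exact hF.insert_add_insert_of_card_inter h2 hij (by grind) (by grind) (by grind) (by grind)
      (by omega) (by omega)
      (Or.inr (by rw [e2, Finset.card_insert_of_notMem hbP]; omega))

theorem IsLineAdditive.insert_add_insert {m : ℕ} {F : Finset α → R}
    (hF : IsLineAdditive m F) (h2 : (2 : R) = 0) (hm : 0 < m) (hn : 3 * m ≤ Fintype.card α)
    {i j : α} (hij : i ≠ j) {X X' : Finset α}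
    (hi : i ∉ X) (hj : j ∉ X) (hi' : i ∉ X') (hj' : j ∉ X')
    (hX : X.card + 1 = 2 * m) (hX' : X'.card + 1 = 2 * m) :
    F (insert i X) + F (insert j X) = F (insert i X') + F (insert j X') := by
  refine eq_of_forall_exchange ({i, j}ᶜ) (2 * m - 1)
    (fun X => F (insert i X) + F (insert j X)) ?_ X X' ?_ ?_ (by omega) (by omega)
  · intro Y a b haS hbS hYS ha hb hab hY
    have hiY : i ∉ Y := fun h => by simpa using hYS h
    have hjY : j ∉ Y := fun h => by simpa using hYS h
    simp only [Finset.mem_compl, Finset.mem_insert, Finset.mem_singleton, not_or] at haS hbS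
    exact hF.insert_add_insert_exchange h2 hm hn hij hab hiY hjY ha hb haS.1 haS.2 hbS.1 hbS.2
      (by omega)
  · intro x hx; simp; grind
  · intro x hx; simp; grind

theorem exists_collinear_avoiding {m : ℕ} (T : Finset α)
    (hn : T.card + 3 * m ≤ Fintype.card α) :
    ∃ I J : Finset α, I.card = 2 * m ∧ J.card = 2 * m ∧ (I ∩ J).card = m ∧
      Disjoint I T ∧ Disjoint J T := by
  obtain ⟨A, hAT, hA⟩ := exists_subset_compl_card_eq T m (by omega)
  have h1 := Finset.card_union_le T A
  obtain ⟨B, hBT, hB⟩ := exists_subset_compl_card_eq (T ∪ A) m (by omega)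
  have h3 := Finset.card_union_le (T ∪ A) B
  obtain ⟨C, hCT, hC⟩ := exists_subset_compl_card_eq (T ∪ A ∪ B) m (by omega)
  simp only [Finset.disjoint_union_right] at hBT hCT
  have hI := Finset.card_union_of_disjoint hBT.2
  have hJ := Finset.card_union_of_disjoint hCT.1.2
  have e : (B ∪ A) ∩ (C ∪ A) = A := by
    rw [← Finset.inter_union_distrib_right, Finset.disjoint_iff_inter_eq_empty.1 hCT.2.symm,
      Finset.empty_union]
  refine ⟨B ∪ A, C ∪ A, by omega, by omega, by rw [e, hA], ?_, ?_⟩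
  · exact Finset.disjoint_union_left.2 ⟨hBT.1, hAT⟩
  · exact Finset.disjoint_union_left.2 ⟨hCT.1.1, hAT⟩

theorem IsLineAdditive.exists_eq_sum {m : ℕ} {F : Finset α → R}
    (hF : IsLineAdditive m F) (h2 : (2 : R) = 0) (hm : 0 < m) (hn : 3 * m ≤ Fintype.card α)
    (hn' : 2 * m + 2 ≤ Fintype.card α) :
    ∃ h : α → R, ∀ I : Finset α, I.card = 2 * m → F I = ∑ i ∈ I, h i := by
  obtain ⟨o⟩ : Nonempty α := Fintype.card_pos_iff.1 (by omega)
  have hex : ∀ i j k : α, ∃ X : Finset α, (i ∉ X ∧ j ∉ X ∧ k ∉ X) ∧ X.card + 1 = 2 * m := by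
    intro i j k
    have := Finset.card_le_three (a := i) (b := j) (c := k)
    obtain ⟨X, hX, hc⟩ := exists_subset_compl_card_eq {i, j, k} (2 * m - 1) (by omega)
    exact ⟨X, by simpa using hX, by omega⟩
  choose Z hZ hZc using fun i => hex i o o
  have key : ∀ i j : α, i ≠ j → ∀ X : Finset α, i ∉ X → j ∉ X → X.card + 1 = 2 * m →
      F (insert i X) + F (insert j X) =
        (F (insert i (Z i)) + F (insert o (Z i))) + (F (insert j (Z j)) + F (insert o (Z j))) := by
    intro i j hij X hi hj hX
    obtain ⟨X', ⟨hi', hj', ho'⟩, hX'⟩ := hex i j o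
    have aux : ∀ k, k ∉ X' → F (insert k (Z k)) + F (insert o (Z k)) =
        F (insert k X') + F (insert o X') := by
      intro k hk
      by_cases hko : k = o
      · subst hko
        linear_combination (F (insert k (Z k)) - F (insert k X')) * h2
      · exact hF.insert_add_insert h2 hm hn hko (hZ k).1 (hZ k).2.1 hk ho' (hZc k) hX'
    rw [aux i hi', aux j hj', hF.insert_add_insert h2 hm hn hij hi hj hi' hj' hX hX']
    linear_combination - F (insert o X') * h2
  set h : α → R := fun i => F (insert i (Z i)) + F (insert o (Z i)) with hh
  have hconst := eq_of_forall_exchange (Finset.univ : Finset α) (2 * m)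
    (fun I => F I + ∑ i ∈ I, h i) (by
      intro Y a b _ _ _ ha hb hab hY
      have := key a b hab Y ha hb hY
      simp only [Finset.sum_insert ha, Finset.sum_insert hb]
      change _ = h a + h b at this
      linear_combination this + (h a - F (insert b Y)) * h2)
  refine ⟨h, fun I hI => ?_⟩
  obtain ⟨A, B, hA, hB, hAB, -, -⟩ := exists_collinear_avoiding (α := α) (m := m) ∅ (by simpa)
  have hS := card_symmDiff_add_two_mul_card_inter A B
  have h3 := hF A B hA hB hAB
  have h4 := sum_symmDiff_of_two_eq_zero h2 h A B
  have c1 := hconst I A (Finset.subset_univ _) (Finset.subset_univ _) hI hA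
  have c2 := hconst I B (Finset.subset_univ _) (Finset.subset_univ _) hI hB
  have c3 := hconst I (A ∆ B) (Finset.subset_univ _) (Finset.subset_univ _) hI (by omega)
  linear_combination c1 + c2 + c3 + h3 + h4 +
    (F A + F B + ∑ i ∈ A, h i + ∑ i ∈ B, h i - F I - 2 * ∑ i ∈ I, h i) * h2

end Additive

section Counting

open Nat

theorem centralBinom_succ_mul_lt {d f : ℕ} (h : d < f) :
    centralBinom (d + 1) * centralBinom f < centralBinom d * centralBinom (f + 1) := by
  have h1 := succ_mul_centralBinom_succ d
  have h2 := succ_mul_centralBinom_succ f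
  have h3 := Nat.mul_pos (centralBinom_pos d) (centralBinom_pos f)
  refine lt_of_mul_lt_mul_left (a := (d + 1) * (f + 1)) ?_ (Nat.zero_le _)
  calc (d + 1) * (f + 1) * (centralBinom (d + 1) * centralBinom f)
      = ((d + 1) * centralBinom (d + 1)) * (f + 1) * centralBinom f := by ring
    _ = (centralBinom d * centralBinom f) * (2 * (2 * d + 1) * (f + 1)) := by rw [h1]; ring
    _ < (centralBinom d * centralBinom f) * (2 * (2 * f + 1) * (d + 1)) :=
        Nat.mul_lt_mul_of_pos_left (by nlinarith) h3
    _ = ((f + 1) * centralBinom (f + 1)) * (d + 1) * centralBinom d := by rw [h2]; ring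
    _ = (d + 1) * (f + 1) * (centralBinom d * centralBinom (f + 1)) := by ring

theorem centralBinom_succ_mul_succ_lt_of_le {d f : ℕ} (hd : 1 ≤ d) (h : d ≤ f) :
    centralBinom (d + 1) * centralBinom (f + 1) < 2 * centralBinom (d + f + 1) := by
  induction d, hd using Nat.le_induction generalizing f with
  | base =>
    have := centralBinom_succ_mul_lt (d := 1) (f := f + 1) (by omega)
    rw [show centralBinom 1 = 2 from rfl] at this
    rwa [show 1 + f + 1 = f + 1 + 1 by omega]
  | succ d hd ih =>
    refine (centralBinom_succ_mul_lt (by omega : d + 1 < f + 1)).trans ?_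
    rw [show d + 1 + f + 1 = d + (f + 1) + 1 by omega]
    exact ih (by omega)

theorem centralBinom_succ_mul_succ_lt {d f : ℕ} (hd : 1 ≤ d) (hf : 1 ≤ f) :
    centralBinom (d + 1) * centralBinom (f + 1) < 2 * centralBinom (d + f + 1) := by
  rcases le_total d f with h | h
  · exact centralBinom_succ_mul_succ_lt_of_le hd h
  · rw [mul_comm, add_comm d f]
    exact centralBinom_succ_mul_succ_lt_of_le hf h

theorem two_mul_choose_add_self_succ (p : ℕ) :
    2 * choose (p + (p + 1)) p = centralBinom (p + 1) := by
  rw [centralBinom_eq_two_mul_choose, show 2 * (p + 1) = (p + (p + 1)) + 1 by ring,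
    choose_succ_succ, ← choose_symm_add (a := p) (b := p + 1)]
  ring

theorem choose_add_succ_mul (p r : ℕ) :
    choose (p + (r + 1)) p * (r + 1) = choose (p + r) p * (p + r + 1) := by
  have := choose_mul_succ_eq (p + r) p
  rw [show p + r + 1 - p = r + 1 by omega] at this
  rw [← add_assoc]
  exact this.symm

theorem centralBinom_mul_choose_le {d p r : ℕ} (hd : 1 ≤ d) (hr : p + 1 ≤ r) :
    centralBinom (d + 1) * choose (p + r) p ≤ 2 * choose ((p + d) + (r + d)) (p + d) ∧
    (¬ (p = 0 ∧ r = 1) →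
      centralBinom (d + 1) * choose (p + r) p < 2 * choose ((p + d) + (r + d)) (p + d)) := by
  induction r, hr using Nat.le_induction with
  | base =>
    have h1 := two_mul_choose_add_self_succ p
    have h2 := two_mul_choose_add_self_succ (p + d)
    rw [show p + 1 + d = p + d + 1 by omega, h2]
    obtain rfl | hp : p = 0 ∨ 1 ≤ p := by omega
    · simp
    · have h3 := centralBinom_succ_mul_succ_lt hd hp
      rw [← h1, add_comm d p] at h3
      have h4 : centralBinom (d + 1) * choose (p + (p + 1)) p < centralBinom (p + d + 1) := by
        linarith
      exact ⟨h4.le, fun _ => h4⟩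
  | succ r hr ih =>
    have h1 := choose_add_succ_mul p r
    have h2 := choose_add_succ_mul (p + d) (r + d)
    have hpos : 0 < choose ((p + d) + (r + d)) (p + d) := choose_pos (by omega)
    have h3 : (p + r + 1) * (r + d + 1) < ((p + d) + (r + d) + 1) * (r + 1) := by nlinarith
    have h4 : centralBinom (d + 1) * choose (p + (r + 1)) p <
        2 * choose ((p + d) + (r + 1 + d)) (p + d) := by
      rw [show r + 1 + d = r + d + 1 by omega]
      refine lt_of_mul_lt_mul_left (a := (r + 1) * (r + d + 1)) ?_ (Nat.zero_le _)
      calc (r + 1) * (r + d + 1) * (centralBinom (d + 1) * choose (p + (r + 1)) p)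
          = centralBinom (d + 1) * (choose (p + (r + 1)) p * (r + 1)) * (r + d + 1) := by ring
        _ = (centralBinom (d + 1) * choose (p + r) p) * ((p + r + 1) * (r + d + 1)) := by
          rw [h1]; ring
        _ ≤ (2 * choose ((p + d) + (r + d)) (p + d)) * ((p + r + 1) * (r + d + 1)) :=
          Nat.mul_le_mul_right _ ih.1
        _ < (2 * choose ((p + d) + (r + d)) (p + d)) * (((p + d) + (r + d) + 1) * (r + 1)) :=
          Nat.mul_lt_mul_of_pos_left h3 (by omega)
        _ = 2 * (choose ((p + d) + (r + d)) (p + d) * ((p + d) + (r + d) + 1)) * (r + 1) := by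
          ring
        _ = (r + 1) * (r + d + 1) * (2 * choose ((p + d) + (r + d + 1)) (p + d)) := by
          rw [← h2]; ring
    exact ⟨h4.le, fun _ => h4⟩

theorem eq_of_two_mul_choose_le {n m e : ℕ} (h1 : n ≠ 4 * m - 1) (h2 : n ≠ 4 * m)
    (he : 2 ≤ e) (hem : e ≤ 2 * m) (hen : e + 2 * m ≤ n)
    (h : 2 * choose (n - 2) (2 * m - 1) ≤ centralBinom e * choose (n - 2 * e) (2 * m - e)) :
    n = 4 * m + 1 ∧ e = 2 * m ∧
      centralBinom e * choose (n - 2 * e) (2 * m - e) ≤ 2 * choose (n - 2) (2 * m - 1) := by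
  obtain ⟨d, rfl⟩ : ∃ d, e = d + 1 := ⟨e - 1, by omega⟩
  obtain ⟨p, hp⟩ := Nat.exists_eq_add_of_le hem
  obtain ⟨r, hr⟩ := Nat.exists_eq_add_of_le hen
  have e1 : n - 2 * (d + 1) = p + r := by omega
  have e2 : 2 * m - (d + 1) = p := by omega
  have e3 : n - 2 = (p + d) + (r + d) := by omega
  have e4 : 2 * m - 1 = p + d := by omega
  rw [e1, e2, e3, e4] at h ⊢
  by_cases hn : 4 * m + 1 ≤ n
  · have key := centralBinom_mul_choose_le (d := d) (p := p) (r := r) (by omega) (by omega)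
    by_cases hpr : p = 0 ∧ r = 1
    · exact ⟨by omega, by omega, key.1⟩
    · exact absurd h (not_le.2 (key.2 hpr))
  · have key := centralBinom_mul_choose_le (d := d) (p := r) (r := p) (by omega) (by omega)
    have := key.2 (by omega)
    rw [add_comm r p, ← choose_symm_add, add_comm (r + d), ← choose_symm_add] at this
    exact absurd h (not_le.2 this)

variable {α : Type*} [Fintype α] [DecidableEq α]

theorem card_filter_card_symmDiff (D : Finset α) (k e : ℕ) (hD : D.card = 2 * e) (hek : e ≤ k) :
    (Finset.univ.filter fun I : Finset α => I.card = k ∧ (I ∆ D).card = k).card =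
      centralBinom e * choose (Fintype.card α - 2 * e) (k - e) := by
  rw [centralBinom_eq_two_mul_choose, ← hD, ← Finset.card_compl, ← Finset.card_powersetCard,
    ← Finset.card_powersetCard, ← Finset.card_product]
  refine Finset.card_nbij' (fun I => (I ∩ D, I \ D)) (fun P => P.1 ∪ P.2) ?_ ?_ ?_ ?_
  · intro I hI
    have hI : I.card = k ∧ (I ∆ D).card = k := by simpa using hI
    have h3 : (I ∆ D).card = (I \ D).card + (D \ I).card := by
      rw [symmDiff_def, Finset.sup_eq_union,
        Finset.card_union_of_disjoint disjoint_sdiff_sdiff]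
    have h4 := Finset.card_sdiff_add_card_inter I D
    have h5 := Finset.card_sdiff_add_card_inter D I
    rw [Finset.inter_comm D I] at h5
    simp only [Finset.coe_product, Set.mem_prod, Finset.mem_coe, Finset.mem_powersetCard]
    refine ⟨⟨Finset.inter_subset_right, by omega⟩, ?_, by omega⟩
    intro x hx
    simp only [Finset.mem_sdiff] at hx
    simpa using hx.2
  · rintro ⟨P, Q⟩ hPQ
    simp only [Finset.coe_product, Set.mem_prod, Finset.mem_coe, Finset.mem_powersetCard] at hPQ
    obtain ⟨⟨hP, hPc⟩, hQ, hQc⟩ := hPQ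
    have hQ' : ∀ x ∈ Q, x ∉ D := fun x hx => Finset.mem_compl.1 (hQ hx)
    have hd : Disjoint P Q := Finset.disjoint_left.2 fun x hx hx' => hQ' x hx' (hP hx)
    have hd' : Disjoint (D \ P) Q :=
      Finset.disjoint_left.2 fun x hx hx' => hQ' x hx' (Finset.mem_sdiff.1 hx).1
    have e1 : (P ∪ Q) ∆ D = (D \ P) ∪ Q := by
      ext x
      have h1 := hQ' x
      have h2 := @hP x
      simp only [Finset.mem_symmDiff, Finset.mem_union, Finset.mem_sdiff]
      tauto
    have h1 := Finset.card_sdiff_of_subset hP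
    simp only [Finset.coe_filter, Finset.mem_univ, true_and, Set.mem_ofPred_eq]
    rw [e1, Finset.card_union_of_disjoint hd, Finset.card_union_of_disjoint hd']
    omega
  · intro I _
    ext x
    simp only [Finset.mem_union, Finset.mem_inter, Finset.mem_sdiff]
    tauto
  · rintro ⟨P, Q⟩ hPQ
    simp only [Finset.coe_product, Set.mem_prod, Finset.mem_coe, Finset.mem_powersetCard] at hPQ
    obtain ⟨⟨hP, -⟩, hQ, -⟩ := hPQ
    have hQ' : ∀ x ∈ Q, x ∉ D := fun x hx => Finset.mem_compl.1 (hQ hx)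
    ext x <;>
    · have h1 := hQ' x
      have h2 := @hP x
      simp only [Finset.mem_union, Finset.mem_inter, Finset.mem_sdiff]
      tauto

end Counting

section Rigidity

variable {α : Type*} [DecidableEq α]

theorem mem_iff_notMem_of_card_inter_pair {S : Finset α} {a b : α} (hab : a ≠ b)
    (h : (S ∩ {a, b}).card = 1) : a ∈ S ↔ b ∉ S := by
  obtain ⟨c, hc⟩ := Finset.card_eq_one.1 h
  have hx : ∀ x, (x ∈ S ∧ (x = a ∨ x = b)) ↔ x = c := by
    intro x
    have := Finset.ext_iff.1 hc x
    simpa using this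
  have ha := hx a
  have hb := hx b
  have hcc := hx c
  constructor
  · intro h1 h2
    exact hab ((ha.1 ⟨h1, Or.inl rfl⟩).trans (hb.1 ⟨h2, Or.inr rfl⟩).symm)
  · intro h1
    obtain ⟨h3, rfl | rfl⟩ := hcc.2 rfl
    · exact h3
    · exact absurd h3 h1

theorem eq_pair_of_mem_of_card {S : Finset α} {a b : α} (hab : a ≠ b) (ha : a ∈ S) (hb : b ∈ S)
    (hS : S.card = 2) : S = {a, b} := by
  refine (Finset.eq_of_subset_of_card_le ?_ ?_).symm
  · intro x hx
    simp only [Finset.mem_insert, Finset.mem_singleton] at hx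
    rcases hx with rfl | rfl <;> assumption
  · rw [hS, Finset.card_pair hab]

variable [Fintype α] {D : α → α → Finset α}

theorem exists_mem_forall_of_card_eq_two (hα : 5 ≤ Fintype.card α)
    (hD : ∀ i j, i ≠ j → (D i j).card = 2) (hcomm : ∀ i j, D i j = D j i)
    (hadd : ∀ i j k, D i k = D i j ∆ D j k) (i : α) :
    ∃ c, ∀ j, j ≠ i → c ∈ D i j := by
  have hinter : ∀ j k, j ≠ i → k ≠ i → j ≠ k → (D i j ∩ D i k).card = 1 := by
    intro j k hj hk hjk
    have h1 := card_symmDiff_add_two_mul_card_inter (D i j) (D i k)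
    rw [hcomm i j, ← hadd j i k, hD j k hjk, hD j i hj, hD i k hk.symm, hcomm j i] at h1
    omega
  obtain ⟨j, hj⟩ := Fintype.exists_ne_of_one_lt_card (by omega) i
  obtain ⟨p, q, hpq, hDj⟩ := Finset.card_eq_two.1 (hD i j hj.symm)
  by_contra! hcon
  obtain ⟨k, hk, hpk⟩ := hcon p
  obtain ⟨l, hl, hql⟩ := hcon q
  have hkj : k ≠ j := by rintro rfl; simp [hDj] at hpk
  have hlj : l ≠ j := by rintro rfl; simp [hDj] at hql
  have pair_j : ∀ l, l ≠ i → l ≠ j → (p ∈ D i l ↔ q ∉ D i l) := fun l hl hlj =>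
    mem_iff_notMem_of_card_inter_pair hpq (by rw [← hDj]; exact hinter l j hl hj hlj)
  have hqk : q ∈ D i k := by have := pair_j k hk hkj; tauto
  have hpl : p ∈ D i l := by have := pair_j l hl hlj; tauto
  have hkl : k ≠ l := by rintro rfl; exact hpk hpl
  obtain ⟨r, hr, hrq⟩ := Finset.exists_mem_ne (by rw [hD i k hk.symm]; omega) q
  have hDk := eq_pair_of_mem_of_card hrq.symm hqk hr (hD i k hk.symm)
  have pair_k : ∀ l, l ≠ i → l ≠ k → (q ∈ D i l ↔ r ∉ D i l) := fun l hl hlk =>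
    mem_iff_notMem_of_card_inter_pair hrq.symm (by rw [← hDk]; exact hinter l k hl hk hlk)
  have hrl : r ∈ D i l := by have := pair_k l hl hkl.symm; tauto
  have hpr : p ≠ r := by rintro rfl; exact hpk hr
  have hDl := eq_pair_of_mem_of_card hpr hpl hrl (hD i l hl.symm)
  obtain ⟨X, hX, hXc⟩ := exists_subset_compl_card_eq ({i, j, k, l} : Finset α) 1
    (by have := Finset.card_le_four (a := i) (b := j) (c := k) (d := l); omega)
  obtain ⟨t, rfl⟩ := Finset.card_eq_one.1 hXc
  have ht : t ≠ i ∧ t ≠ j ∧ t ≠ k ∧ t ≠ l := by simpa using hX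
  have h1 := pair_j t ht.1 ht.2.1
  have h2 := pair_k t ht.1 ht.2.2.1
  have h3 := mem_iff_notMem_of_card_inter_pair (S := D i t) hpr
    (by rw [← hDl]; exact hinter t l ht.1 hl ht.2.2.2)
  tauto

theorem exists_perm_eq_pair (hα : 5 ≤ Fintype.card α)
    (hD : ∀ i j, i ≠ j → (D i j).card = 2) (hcomm : ∀ i j, D i j = D j i)
    (hadd : ∀ i j k, D i k = D i j ∆ D j k) :
    ∃ σ : Equiv.Perm α, ∀ i j, i ≠ j → D i j = {σ i, σ j} := by
  choose s hs using exists_mem_forall_of_card_eq_two hα hD hcomm hadd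
  have hinj : Function.Injective s := by
    intro i j hij
    by_contra hne
    obtain ⟨X, hX, hXc⟩ := exists_subset_compl_card_eq ({i, j} : Finset α) 1
      (by have := Finset.card_le_two (a := i) (b := j); omega)
    obtain ⟨k, rfl⟩ := Finset.card_eq_one.1 hXc
    have hk : k ≠ i ∧ k ≠ j := by simpa using hX
    have h1 := hs i j (Ne.symm hne)
    have h2 := hs i k hk.1
    have h3 := hs j k hk.2
    rw [hadd i k j, hcomm k j, Finset.mem_symmDiff] at h1
    rw [← hij] at h3
    tauto
  refine ⟨Equiv.ofBijective s (Finite.injective_iff_bijective.1 hinj), fun i j hij => ?_⟩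
  refine eq_pair_of_mem_of_card (hinj.ne hij) (hs i j hij.symm) ?_ (hD i j hij)
  rw [hcomm]
  exact hs j i hij

end Rigidity

section Automorphism

/-- The characteristic vector of a finite set over the two-element field. -/
def charVec {α : Type*} [DecidableEq α] (S : Finset α) : α → ZMod 2 :=
  fun x => if x ∈ S then 1 else 0

variable {α : Type*} [DecidableEq α]

theorem charVec_injective : Function.Injective (charVec : Finset α → α → ZMod 2) := by
  intro S T h
  ext x
  have := congrFun h x
  simp only [charVec] at this
  by_cases h1 : x ∈ S <;> by_cases h2 : x ∈ T <;> simp_all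

theorem charVec_symmDiff (S T : Finset α) : charVec (S ∆ T) = charVec S + charVec T := by
  ext x
  simp only [charVec, Pi.add_apply, Finset.mem_symmDiff]
  by_cases h1 : x ∈ S <;> by_cases h2 : x ∈ T <;> simp [h1, h2]; rfl

theorem pi_zmod_two_two_eq_zero {α : Type*} : (2 : α → ZMod 2) = 0 := by
  ext x
  rfl

theorem sum_charVec_singleton (σ : Equiv.Perm α) (I : Finset α) :
    ∑ i ∈ I, charVec {σ i} = charVec (I.image σ) := by
  ext x
  simp only [Finset.sum_apply, charVec, Finset.mem_singleton, ← Equiv.symm_apply_eq σ]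
  rw [Finset.sum_ite_eq]
  have hx : x ∈ I.image σ ↔ σ.symm x ∈ I := by
    rw [Finset.mem_image]
    exact ⟨by rintro ⟨a, ha, rfl⟩; simpa, fun hx => ⟨_, hx, σ.apply_symm_apply x⟩⟩
  simp only [hx]

/-- The set of coordinates in which `h i` and `h j` differ. -/
def diffSet {n : ℕ} (h : Fin n → Fin n → ZMod 2) (i j : Fin n) : Finset (Fin n) :=
  Finset.univ.filter fun x => h i x ≠ h j x

variable {n m : ℕ} {f : Finset (Fin n) → Finset (Fin n)} {h : Fin n → Fin n → ZMod 2}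

theorem charVec_diffSet (h : Fin n → Fin n → ZMod 2) (i j : Fin n) :
    charVec (diffSet h i j) = h i + h j := by
  ext x
  have key : ∀ a b : ZMod 2, (if a ≠ b then (1 : ZMod 2) else 0) = a + b := by decide
  simp only [charVec, diffSet, Finset.mem_filter, Finset.mem_univ, true_and, Pi.add_apply]
  exact key _ _

theorem diffSet_comm (h : Fin n → Fin n → ZMod 2) (i j : Fin n) :
    diffSet h i j = diffSet h j i :=
  charVec_injective (by rw [charVec_diffSet, charVec_diffSet, add_comm])

theorem diffSet_eq_symmDiff (h : Fin n → Fin n → ZMod 2) (i j k : Fin n) :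
    diffSet h i k = diffSet h i j ∆ diffSet h j k := by
  apply charVec_injective
  rw [charVec_symmDiff, charVec_diffSet, charVec_diffSet, charVec_diffSet]
  linear_combination - h j * pi_zmod_two_two_eq_zero (α := Fin n)

theorem map_symmDiff_pair_eq
    (hh : ∀ I : Finset (Fin n), I.card = 2 * m → charVec (f I) = ∑ i ∈ I, h i)
    {i j : Fin n} (hij : i ≠ j) {I : Finset (Fin n)} (hI : I.card = 2 * m)
    (hI' : (I ∆ {i, j}).card = 2 * m) :
    f (I ∆ {i, j}) = f I ∆ diffSet h i j := by
  apply charVec_injective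
  rw [hh _ hI', charVec_symmDiff, charVec_diffSet, hh _ hI,
    sum_symmDiff_of_two_eq_zero pi_zmod_two_two_eq_zero, Finset.sum_pair hij]

theorem card_diffSet (hm : 0 < m) (h1 : n ≠ 4 * m - 1) (h2 : n ≠ 4 * m) (hn : 2 * m + 2 ≤ n)
    (hf : IsAutPm n m f)
    (hh : ∀ I : Finset (Fin n), I.card = 2 * m → charVec (f I) = ∑ i ∈ I, h i)
    {i j : Fin n} (hij : i ≠ j) : (diffSet h i j).card = 2 := by
  obtain ⟨⟨hmaps, hinj, -⟩, -, hline⟩ := hf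
  have hcf : ∀ I : Finset (Fin n), I.card = 2 * m → (f I).card = 2 * m := fun I hI => hmaps hI
  set D := diffSet h i j with hDdef
  set A := Finset.univ.filter fun I : Finset (Fin n) => I.card = 2 * m ∧ (I ∆ {i, j}).card = 2 * m
    with hA
  set B := Finset.univ.filter fun I : Finset (Fin n) => I.card = 2 * m ∧ (I ∆ D).card = 2 * m
    with hB
  have memA : ∀ I, I ∈ A ↔ I.card = 2 * m ∧ (I ∆ {i, j}).card = 2 * m := by simp [hA]
  have memB : ∀ I, I ∈ B ↔ I.card = 2 * m ∧ (I ∆ D).card = 2 * m := by simp [hB]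
  have cardA : A.card = 2 * Nat.choose (n - 2) (2 * m - 1) := by
    have := card_filter_card_symmDiff ({i, j} : Finset (Fin n)) (2 * m) 1
      (Finset.card_pair hij) (by omega)
    rw [Fintype.card_fin] at this
    exact this
  have hAB : A.image f ⊆ B := by
    intro S hS
    obtain ⟨I, hI, rfl⟩ := Finset.mem_image.1 hS
    rw [memA] at hI
    rw [memB, ← map_symmDiff_pair_eq hh hij hI.1 hI.2]
    exact ⟨hcf _ hI.1, hcf _ hI.2⟩
  have hinjA : Set.InjOn f A := by
    intro I hI J hJ hIJ
    exact hinj ((memA I).1 hI).1 ((memA J).1 hJ).1 hIJ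
  have himg := Finset.card_image_of_injOn hinjA
  have hle : A.card ≤ B.card := himg ▸ Finset.card_le_card hAB
  have hpos : 0 < A.card := by
    have := Nat.choose_pos (n := n - 2) (k := 2 * m - 1) (by omega)
    omega
  obtain ⟨I, hI⟩ := Finset.card_pos.1 hpos
  have hfI := (memB _).1 (hAB (Finset.mem_image_of_mem f hI))
  have hcs := card_symmDiff_add_two_mul_card_inter (f I) D
  have hcu := Finset.card_union_add_card_inter (f I) D
  have hun := Finset.card_le_univ (f I ∪ D)
  rw [Fintype.card_fin] at hun
  have hle2 := Finset.card_le_card (Finset.inter_subset_left (s₁ := f I) (s₂ := D))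
  obtain ⟨e, he⟩ : ∃ e, e = (f I ∩ D).card := ⟨_, rfl⟩
  have hDe : D.card = 2 * e := by omega
  have cardB := card_filter_card_symmDiff D (2 * m) e hDe (by omega)
  rw [Fintype.card_fin] at cardB
  change B.card = _ at cardB
  have he0 : e ≠ 0 := by
    intro he0
    have hD0 : D = ∅ := Finset.card_eq_zero.1 (by omega)
    rw [memA] at hI
    have h3 := map_symmDiff_pair_eq hh hij hI.1 hI.2
    rw [← hDdef, hD0, ← Finset.bot_eq_empty, symmDiff_bot] at h3
    have h4 := symmDiff_eq_left.1 (hinj hI.2 hI.1 h3)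
    simp at h4
  by_contra hD2
  obtain ⟨hn1, hem, hBA⟩ := eq_of_two_mul_choose_le (n := n) (m := m) (e := e) h1 h2 (by omega)
    (by omega) (by omega) (by omega)
  have himgB : A.image f = B := Finset.eq_of_subset_of_card_le hAB (by omega)
  obtain ⟨x, hx⟩ : ∃ x, Dᶜ = {x} := by
    rw [← Finset.card_eq_one, Finset.card_compl, Fintype.card_fin]
    omega
  have hxmem : ∀ J : Finset (Fin n), J.card = 2 * m → Disjoint J {i, j} → x ∈ f J := by
    intro J hJ hd
    by_contra hxJ
    have hsub : f J ⊆ D := by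
      intro y hy
      by_contra hyD
      rw [← Finset.mem_compl, hx, Finset.mem_singleton] at hyD
      exact hxJ (hyD ▸ hy)
    have hc := card_symmDiff_add_two_mul_card_inter (f J) D
    rw [Finset.inter_eq_left.2 hsub, hcf J hJ] at hc
    have hJB : f J ∈ B := (memB _).2 ⟨hcf J hJ, by omega⟩
    rw [← himgB, Finset.mem_image] at hJB
    obtain ⟨K, hK, hKJ⟩ := hJB
    rw [memA] at hK
    obtain rfl := hinj hK.1 hJ hKJ
    have hc' := card_symmDiff_add_two_mul_card_inter K {i, j}
    rw [Finset.disjoint_iff_inter_eq_empty.1 hd, Finset.card_pair hij] at hc'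
    simp only [Finset.card_empty] at hc'
    omega
  obtain ⟨P, Q, hP, hQ, hPQ, hPd, hQd⟩ := exists_collinear_avoiding (m := m)
    ({i, j} : Finset (Fin n)) (by rw [Finset.card_pair hij, Fintype.card_fin]; omega)
  have hcPQ := card_symmDiff_add_two_mul_card_inter P Q
  have hdPQ : Disjoint (P ∆ Q) {i, j} := by
    rw [Finset.disjoint_left] at hPd hQd ⊢
    intro y hy
    rcases Finset.mem_symmDiff.1 hy with hy | hy
    · exact hPd hy.1
    · exact hQd hy.1
  have hxPQ := hxmem (P ∆ Q) (by omega) hdPQ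
  rw [hline P Q hP hQ hPQ, Finset.mem_symmDiff] at hxPQ
  have := hxmem P hP hPd
  have := hxmem Q hQ hQd
  tauto

end Automorphism

/-- If `3m ≤ n` and `n ∉ {4m - 1, 4m}`, then every automorphism of `P_m` is induced by a
permutation of `{1,…,n}`. -/
theorem stmt_6 (n m : ℕ) (hm : 0 < m) (hn : 3 * m ≤ n)
    (h1 : n ≠ 4 * m - 1) (h2 : n ≠ 4 * m)
    (f : Finset (Fin n) → Finset (Fin n)) (hf : IsAutPm n m f) :
    ∃ σ : Equiv.Perm (Fin n), ∀ I : Finset (Fin n), I.card = 2 * m →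
      f I = I.image σ := by
  have htwo := pi_zmod_two_two_eq_zero (α := Fin n)
  have hadd : IsLineAdditive m fun I => charVec (f I) := fun I J hI hJ hIJ => by
    simp only [hf.2.2 I J hI hJ hIJ, charVec_symmDiff]
  obtain ⟨h, hh⟩ := hadd.exists_eq_sum htwo hm (by rwa [Fintype.card_fin])
    (by rw [Fintype.card_fin]; omega)
  obtain ⟨σ, hσ⟩ := exists_perm_eq_pair (D := diffSet h) (by rw [Fintype.card_fin]; omega)
    (fun i j hij => card_diffSet hm h1 h2 (by omega) hf hh hij) (diffSet_comm h)
    (diffSet_eq_symmDiff h)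
  refine ⟨σ, fun I hI => charVec_injective ?_⟩
  let o : Fin n := ⟨0, by omega⟩
  have hconst : ∀ i, h i = charVec {σ i} + (h o + charVec {σ o}) := by
    intro i
    by_cases hio : i = o
    · rw [hio]
      linear_combination - charVec {σ o} * htwo
    · have h3 := charVec_diffSet h i o
      have hd : ({σ i, σ o} : Finset (Fin n)) = {σ i} ∆ {σ o} := by
        have := σ.injective.ne hio
        ext x
        simp only [Finset.mem_insert, Finset.mem_singleton, Finset.mem_symmDiff]
        grind
      rw [hσ i o hio, hd, charVec_symmDiff] at h3
      linear_combination -h3 - h o * htwo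
  rw [hh I hI, Finset.sum_congr rfl fun i _ => hconst i, Finset.sum_add_distrib,
    sum_charVec_singleton, Finset.sum_const, hI, nsmul_eq_mul]
  push_cast
  linear_combination m * (h o + charVec {σ o}) * htwo
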